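/- arXiv:2103.04888 — 6 statements merged into one kernel-verified Lean document; each statement's English description precedes it below -/
import Mathlib

section
/- Let ℓ ≥ 1 and let a, b : Fin ℓ → ℕ with a ≠ 0, b ≠ 0, and such that there exist at least two distinct indices i with a_i + b_i > 0 (i.e. a + b is not a univariate degree). Then ∏_{i} (a_i + b_i + 1) + 1 > ∏_{i} (a_i + 1) + ∏_{i} (b_i + 1); equivalently ⟨a+b⟩ > ⟨a⟩ + ⟨b⟩ − 1 where ⟨n⟩ := ∏_i (n_i + 1). -/
/-- The weak dimension count `⟨a⟩ + ⟨b⟩ ≤ ⟨a + b⟩ + 1`, valid for all degrees. -/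
theorem prod_add_one_add_prod_add_one_le {ι : Type*} (s : Finset ι) (a b : ι → ℕ) :
    ∏ i ∈ s, (a i + 1) + ∏ i ∈ s, (b i + 1) ≤ ∏ i ∈ s, (a i + b i + 1) + 1 := by
  classical
  induction s using Finset.induction_on with
  | empty => simp
  | insert i s hi ih =>
    have hA : ∏ i ∈ s, (a i + 1) ≤ ∏ i ∈ s, (a i + b i + 1) :=
      Finset.prod_le_prod' fun k _ => by omega
    have hB : ∏ i ∈ s, (b i + 1) ≤ ∏ i ∈ s, (a i + b i + 1) :=
      Finset.prod_le_prod' fun k _ => by omega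
    simp only [Finset.prod_insert hi]
    nlinarith [Nat.mul_le_mul_left (a i) hA, Nat.mul_le_mul_left (b i) hB]

/-- The dimension count is strict as soon as `a` and `b` are nonzero at two distinct indices. -/
theorem prod_add_one_add_prod_add_one_lt {ι : Type*} [Fintype ι] (a b : ι → ℕ) {i j : ι}
    (hij : i ≠ j) (hi : 0 < a i) (hj : 0 < b j) :
    ∏ k, (a k + 1) + ∏ k, (b k + 1) < ∏ k, (a k + b k + 1) + 1 := by
  classical
  have hweak := prod_add_one_add_prod_add_one_le (Finset.univ.erase i) a b
  have hA : ∏ k ∈ Finset.univ.erase i, (a k + 1) < ∏ k ∈ Finset.univ.erase i, (a k + b k + 1) :=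
    Finset.prod_lt_prod (fun k _ => by omega) (fun k _ => by omega)
      ⟨j, by simp [hij.symm], by omega⟩
  have hB : ∏ k ∈ Finset.univ.erase i, (b k + 1) ≤ ∏ k ∈ Finset.univ.erase i, (a k + b k + 1) :=
    Finset.prod_le_prod' fun k _ => by omega
  simp only [← Finset.mul_prod_erase Finset.univ _ (Finset.mem_univ i)]
  nlinarith [Nat.mul_lt_mul_of_pos_left hA hi, Nat.mul_le_mul_left (b i) hB]

/-- Two nonzero degrees whose sum is not univariate are nonzero at two distinct indices. -/
theorem exists_ne_pos_pos {ι : Type*} {a b : ι → ℕ} (ha : a ≠ 0) (hb : b ≠ 0)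
    (hab : ∃ i j : ι, i ≠ j ∧ 0 < a i + b i ∧ 0 < a j + b j) :
    ∃ i j : ι, i ≠ j ∧ 0 < a i ∧ 0 < b j := by
  obtain ⟨p, hp⟩ := Function.ne_iff.mp ha
  obtain ⟨q, hq⟩ := Function.ne_iff.mp hb
  replace hp : 0 < a p := Nat.pos_of_ne_zero hp
  replace hq : 0 < b q := Nat.pos_of_ne_zero hq
  by_cases hpq : p = q
  · subst hpq
    obtain ⟨k, hkp, hk⟩ : ∃ k, k ≠ p ∧ 0 < a k + b k := by
      obtain ⟨i, j, hij, hi, hj⟩ := hab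
      by_cases hip : i = p
      · exact ⟨j, fun h => hij (hip.trans h.symm), hj⟩
      · exact ⟨i, hip, hi⟩
    rcases Nat.eq_zero_or_pos (a k) with h | h
    · exact ⟨p, k, hkp.symm, hp, by omega⟩
    · exact ⟨k, p, hkp, h, hq⟩
  · exact ⟨p, q, hpq, hp, hq⟩

/-- Dimension-count inequality: for `ℓ`-tuple degrees `a ≠ 0` and `b ≠ 0` whose sum is a
non-univariate degree (at least two distinct indices `i` with `a_i + b_i > 0`),
`⟨a+b⟩ > ⟨a⟩ + ⟨b⟩ − 1`, i.e. `∏ (a_i+b_i+1) + 1 > ∏ (a_i+1) + ∏ (b_i+1)`. -/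
theorem dim_count_inequality (ℓ : ℕ) (hl : 1 ≤ ℓ) (a b : Fin ℓ → ℕ)
    (ha : a ≠ 0) (hb : b ≠ 0)
    (hab : ∃ i j : Fin ℓ, i ≠ j ∧ 0 < a i + b i ∧ 0 < a j + b j) :
    ∏ i, (a i + b i + 1) + 1 > ∏ i, (a i + 1) + ∏ i, (b i + 1) := by
  obtain ⟨i, j, hij, hi, hj⟩ := exists_ne_pos_pos ha hb hab
  exact prod_add_one_add_prod_add_one_lt a b hij hi hj
end

section
/- For every m ∈ ℕ^ℓ, the set {f ∈ ℙ^m : deg f = m and f is irreducible in R} is an open subset of ℙ^m. -/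
open scoped Classical

/-- The Hermitian inner product on coefficients of multivariate polynomials
(conjugate-linear in the first argument). -/
noncomputable def pInner {ℓ : ℕ} (p q : MvPolynomial (Fin ℓ) ℂ) : ℂ :=
  ∑ d ∈ p.support ∪ q.support, (starRingEnd ℂ) (MvPolynomial.coeff d p) * MvPolynomial.coeff d q

/-- The coefficient norm `‖p‖ := √⟪p,p⟫`. -/
noncomputable def pNorm {ℓ : ℕ} (p : MvPolynomial (Fin ℓ) ℂ) : ℝ :=
  Real.sqrt (pInner p p).re

open Filter Topology MvPolynomial

theorem pInner_self_re {ℓ : ℕ} (p : MvPolynomial (Fin ℓ) ℂ) :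
    (pInner p p).re = ∑ d ∈ p.support, ‖coeff d p‖ ^ 2 := by
  simp only [pInner, Finset.union_idempotent, Complex.re_sum]
  refine Finset.sum_congr rfl fun d _ => ?_
  rw [← Complex.normSq_eq_conj_mul_self, Complex.ofReal_re, Complex.normSq_eq_norm_sq]

theorem norm_coeff_le_pNorm {ℓ : ℕ} (p : MvPolynomial (Fin ℓ) ℂ) (d : Fin ℓ →₀ ℕ) :
    ‖coeff d p‖ ≤ pNorm p := by
  by_cases hd : d ∈ p.support
  · rw [pNorm, pInner_self_re]
    exact Real.le_sqrt_of_sq_le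
      (Finset.single_le_sum (f := fun e => ‖coeff e p‖ ^ 2) (fun _ _ => sq_nonneg _) hd)
  · rw [notMem_support_iff.1 hd, norm_zero]
    exact Real.sqrt_nonneg _

/-- Every nonzero polynomial has a scalar multiple whose largest coefficient is `1`. -/
theorem exists_normalized {σ : Type*} {p : MvPolynomial σ ℂ} (hp : p ≠ 0) :
    ∃ c : ℂ, c ≠ 0 ∧ (∃ d, coeff d (C c * p) = 1) ∧
      ∀ e, ‖coeff e (C c * p)‖ ≤ 1 := by
  obtain ⟨d, hd, hmax⟩ := p.support.exists_max_image (fun e => ‖coeff e p‖)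
    (support_nonempty.2 hp)
  have hd0 : coeff d p ≠ 0 := mem_support_iff.1 hd
  refine ⟨(coeff d p)⁻¹, inv_ne_zero hd0, ⟨d, by simp [hd0]⟩, fun e => ?_⟩
  rw [coeff_C_mul, norm_mul, norm_inv, inv_mul_le_one₀ (norm_pos_iff.2 hd0)]
  by_cases he : e ∈ p.support
  · exact hmax e he
  · simp [notMem_support_iff.1 he]

theorem le_equivFunOnFinite_symm_of_degreeOf_le {ℓ : ℕ} {p : MvPolynomial (Fin ℓ) ℂ}
    {m : Fin ℓ → ℕ} (h : ∀ i, p.degreeOf i ≤ m i) {d : Fin ℓ →₀ ℕ} (hd : d ∈ p.support) :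
    d ≤ Finsupp.equivFunOnFinite.symm m :=
  fun i => (monomial_le_degreeOf i hd).trans (h i)

/-- Along an ultrafilter, a function taking values in a finite set is eventually constant. -/
theorem Ultrafilter.exists_eventually_eq_of_mem_finset {ι α : Type*} (U : Ultrafilter ι)
    (s : Finset α) {u : ι → α} (h : ∀ᶠ n in U, u n ∈ s) : ∃ x ∈ s, ∀ᶠ n in U, u n = x := by
  have hmem : (⋃ x ∈ (s : Set α), {n | u n = x}) ∈ U := by
    filter_upwards [h] with n hn
    simpa using hn
  exact (Ultrafilter.finite_biUnion_mem_iff s.finite_toSet).1 hmem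

/-- Along an ultrafilter, polynomials of bounded degrees with bounded coefficients converge. -/
theorem exists_tendsto_coeff {ι : Type*} (U : Ultrafilter ι) {ℓ : ℕ} {m : Fin ℓ → ℕ}
    {p : ι → MvPolynomial (Fin ℓ) ℂ} (hdeg : ∀ᶠ n in U, ∀ i, (p n).degreeOf i ≤ m i)
    (hbound : ∀ᶠ n in U, ∀ d, ‖coeff d (p n)‖ ≤ 1) :
    ∃ q : MvPolynomial (Fin ℓ) ℂ, ∀ d, Tendsto (fun n => coeff d (p n)) U (𝓝 (coeff d q)) := by
  have hlim : ∀ d, ∃ x : ℂ, Tendsto (fun n => coeff d (p n)) U (𝓝 x) := by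
    intro d
    have hmem : ((U.map fun n => coeff d (p n) : Ultrafilter ℂ) : Filter ℂ) ≤
        𝓟 (Metric.closedBall 0 1) := by
      rw [le_principal_iff]
      change ∀ᶠ n in U, coeff d (p n) ∈ Metric.closedBall (0 : ℂ) 1
      filter_upwards [hbound] with n hn
      simpa using hn d
    obtain ⟨x, -, hx⟩ := (isCompact_closedBall (0 : ℂ) 1).ultrafilter_le_nhds _ hmem
    exact ⟨x, hx⟩
  choose L hL using hlim
  refine ⟨∑ e ∈ Finset.Iic (Finsupp.equivFunOnFinite.symm m), monomial e (L e), fun d => ?_⟩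
  simp only [coeff_sum, coeff_monomial, Finset.sum_ite_eq', Finset.mem_Iic]
  split_ifs with hd
  · exact hL d
  · refine tendsto_const_nhds.congr' ?_
    filter_upwards [hdeg] with n hn
    by_contra hne
    exact hd (le_equivFunOnFinite_symm_of_degreeOf_le hn (mem_support_iff.2 (Ne.symm hne)))

theorem tendsto_coeff_mul {ι σ : Type*} {F : Filter ι} {p q : ι → MvPolynomial σ ℂ}
    {p₀ q₀ : MvPolynomial σ ℂ}
    (hp : ∀ d, Tendsto (fun n => coeff d (p n)) F (𝓝 (coeff d p₀)))
    (hq : ∀ d, Tendsto (fun n => coeff d (q n)) F (𝓝 (coeff d q₀))) (d : σ →₀ ℕ) :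
    Tendsto (fun n => coeff d (p n * q n)) F (𝓝 (coeff d (p₀ * q₀))) := by
  simp only [coeff_mul]
  exact tendsto_finsetSum _ fun x _ => (hp x.1).mul (hq x.2)

/-- The degree in each variable can only drop in a coefficientwise limit. -/
theorem eventually_degreeOf_le {ι σ : Type*} {F : Filter ι}
    {p : ι → MvPolynomial σ ℂ} {q : MvPolynomial σ ℂ}
    (h : ∀ d, Tendsto (fun n => coeff d (p n)) F (𝓝 (coeff d q))) (i : σ) :
    ∀ᶠ n in F, q.degreeOf i ≤ (p n).degreeOf i := by
  have hev : ∀ᶠ n in F, ∀ d ∈ q.support, coeff d (p n) ≠ 0 :=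
    (Filter.eventually_all_finset _).2 fun d hd =>
      (h d).eventually_ne (mem_support_iff.1 hd)
  filter_upwards [hev] with n hn
  exact degreeOf_le_iff.2 fun d hd => monomial_le_degreeOf i (mem_support_iff.2 (hn d hd))

theorem isUnit_of_degreeOf_eq_zero {σ : Type*} {p : MvPolynomial σ ℂ} (hp : p ≠ 0)
    (h : ∀ i, p.degreeOf i = 0) : IsUnit p := by
  have hC : p = C (coeff 0 p) := by
    ext d
    rw [coeff_C]
    split_ifs with hd
    · rw [hd]
    · by_contra hne
      refine hd (Finsupp.ext fun i => ?_)
      have := monomial_le_degreeOf i (mem_support_iff.2 hne)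
      have := h i
      simp only [Finsupp.coe_zero, Pi.zero_apply]
      omega
  rw [hC]
  refine (isUnit_iff_ne_zero.2 fun h0 => hp ?_).map C
  rw [hC, h0, C_0]

theorem degreeOf_eq_zero_of_isUnit {σ : Type*} {p : MvPolynomial σ ℂ} (hp : IsUnit p) (i : σ) :
    p.degreeOf i = 0 := by
  obtain ⟨q, hq⟩ := hp.exists_right_inv
  have h := degreeOf_mul_eq (n := i) hp.ne_zero (right_ne_zero_of_mul_eq_one hq)
  rw [hq, degreeOf_one] at h
  omega

theorem degreeOf_C_mul_of_ne_zero {σ : Type*} {c : ℂ} (hc : c ≠ 0) (p : MvPolynomial σ ℂ)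
    (i : σ) : (C c * p).degreeOf i = p.degreeOf i := by
  rcases eq_or_ne p 0 with rfl | hp
  · simp
  · rw [degreeOf_mul_eq (C_ne_zero.2 hc) hp, degreeOf_C, zero_add]

/-- A reducible nonzero polynomial is a scalar times a product of two nonconstant polynomials
whose largest coefficient is `1`. -/
theorem exists_normalized_factorization {σ : Type*} {g : MvPolynomial σ ℂ} (hg0 : g ≠ 0)
    (hgu : ¬IsUnit g) (hg : ¬Irreducible g) :
    ∃ (k : ℂ) (a b : MvPolynomial σ ℂ), g = C k * (a * b) ∧ ¬IsUnit a ∧ ¬IsUnit b ∧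
      (∀ i, g.degreeOf i = a.degreeOf i + b.degreeOf i) ∧
      (∃ d, coeff d a = 1) ∧ (∃ d, coeff d b = 1) ∧
      (∀ d, ‖coeff d a‖ ≤ 1) ∧ ∀ d, ‖coeff d b‖ ≤ 1 := by
  obtain ⟨a, b, rfl, ha, hb⟩ : ∃ a b, g = a * b ∧ ¬IsUnit a ∧ ¬IsUnit b := by
    rw [irreducible_iff] at hg
    push Not at hg
    obtain ⟨a, b, h⟩ := hg hgu
    exact ⟨a, b, h⟩
  have ha0 := left_ne_zero_of_mul hg0
  have hb0 := right_ne_zero_of_mul hg0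
  obtain ⟨s, hs, ⟨d, hd⟩, hsa⟩ := exists_normalized ha0
  obtain ⟨t, ht, ⟨e, he⟩, htb⟩ := exists_normalized hb0
  refine ⟨s⁻¹ * t⁻¹, C s * a, C t * b, ?_, fun h => ha (isUnit_of_mul_isUnit_right h),
    fun h => hb (isUnit_of_mul_isUnit_right h), fun i => ?_, ⟨d, hd⟩, ⟨e, he⟩, hsa, htb⟩
  · have h : (C (s⁻¹ * t⁻¹) * (C s * C t) : MvPolynomial σ ℂ) = 1 := by
      rw [← C_mul, ← C_mul, ← C_1]
      congr 1
      field_simp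
    linear_combination (-(a * b)) * h
  · rw [degreeOf_C_mul_of_ne_zero hs, degreeOf_C_mul_of_ne_zero ht, degreeOf_mul_eq ha0 hb0]

theorem Ultrafilter.exists_eventually_coeff_eq_one {ι : Type*} (U : Ultrafilter ι) {ℓ : ℕ}
    {m : Fin ℓ → ℕ} {p : ι → MvPolynomial (Fin ℓ) ℂ}
    (hdeg : ∀ᶠ n in U, ∀ i, (p n).degreeOf i ≤ m i)
    (hone : ∀ᶠ n in U, ∃ d, coeff d (p n) = 1) :
    ∃ d, ∀ᶠ n in U, coeff d (p n) = 1 := by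
  have h : ∀ n, ∃ d, (∃ e, coeff e (p n) = 1) → coeff d (p n) = 1 := fun n => by
    by_cases hn : ∃ e, coeff e (p n) = 1
    · exact ⟨hn.choose, fun _ => hn.choose_spec⟩
    · exact ⟨0, fun h => absurd h hn⟩
  choose u hu using h
  obtain ⟨d, -, hd⟩ := U.exists_eventually_eq_of_mem_finset
    (Finset.Iic (Finsupp.equivFunOnFinite.symm m)) (u := u) (by
      filter_upwards [hdeg, hone] with n hn hone_n
      refine Finset.mem_Iic.2 (le_equivFunOnFinite_symm_of_degreeOf_le hn (mem_support_iff.2 ?_))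
      rw [hu n hone_n]
      exact one_ne_zero)
  refine ⟨d, ?_⟩
  filter_upwards [hd, hone] with n hn hone_n
  rw [← hn]
  exact hu n hone_n

/-- If polynomials with the same degrees as an irreducible `f` converge to `f` coefficientwise
along an ultrafilter, then they are eventually irreducible. -/
theorem eventually_irreducible {ι : Type*} (U : Ultrafilter ι) {ℓ : ℕ}
    {f : MvPolynomial (Fin ℓ) ℂ} {g : ι → MvPolynomial (Fin ℓ) ℂ} (hf : Irreducible f)
    (hdeg : ∀ᶠ n in U, ∀ i, (g n).degreeOf i = f.degreeOf i)
    (hlim : ∀ d, Tendsto (fun n => coeff d (g n)) U (𝓝 (coeff d f))) :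
    ∀ᶠ n in U, Irreducible (g n) := by
  by_contra hred
  rw [← Ultrafilter.eventually_not] at hred
  have hgu : ∀ᶠ n in U, g n ≠ 0 ∧ ¬IsUnit (g n) := by
    filter_upwards [hdeg] with n hn
    have hnz : ¬∀ i, f.degreeOf i = 0 := fun h =>
      hf.not_isUnit (isUnit_of_degreeOf_eq_zero hf.ne_zero h)
    refine ⟨fun h0 => hnz fun i => ?_, fun hu => hnz fun i => ?_⟩
    · rw [← hn i, h0, degreeOf_zero]
    · rw [← hn i, degreeOf_eq_zero_of_isUnit hu]
  have hfac : ∀ n, ∃ (k : ℂ) (a b : MvPolynomial (Fin ℓ) ℂ),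
      g n ≠ 0 → ¬IsUnit (g n) → ¬Irreducible (g n) →
      g n = C k * (a * b) ∧ ¬IsUnit a ∧ ¬IsUnit b ∧
      (∀ i, (g n).degreeOf i = a.degreeOf i + b.degreeOf i) ∧
      (∃ d, coeff d a = 1) ∧ (∃ d, coeff d b = 1) ∧
      (∀ d, ‖coeff d a‖ ≤ 1) ∧ ∀ d, ‖coeff d b‖ ≤ 1 := by
    intro n
    by_cases h : g n ≠ 0 ∧ ¬IsUnit (g n) ∧ ¬Irreducible (g n)
    · obtain ⟨k, a, b, hkab⟩ := exists_normalized_factorization h.1 h.2.1 h.2.2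
      exact ⟨k, a, b, fun _ _ _ => hkab⟩
    · exact ⟨0, 0, 0, fun h₁ h₂ h₃ => absurd ⟨h₁, h₂, h₃⟩ h⟩
  choose k a b hkab using hfac
  replace hkab := (hgu.and hred).mono fun n hn => hkab n hn.1.1 hn.1.2 hn.2
  have hsum : ∀ᶠ n in U, ∀ i, f.degreeOf i = (a n).degreeOf i + (b n).degreeOf i :=
    (hkab.and hdeg).mono fun n hn i => (hn.2 i).symm.trans (hn.1.2.2.2.1 i)
  have hadeg : ∀ᶠ n in U, ∀ i, (a n).degreeOf i ≤ f.degreeOf i :=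
    hsum.mono fun n hn i => (hn i).symm ▸ Nat.le_add_right _ _
  have hbdeg : ∀ᶠ n in U, ∀ i, (b n).degreeOf i ≤ f.degreeOf i :=
    hsum.mono fun n hn i => (hn i).symm ▸ Nat.le_add_left _ _
  obtain ⟨A, hA⟩ := exists_tendsto_coeff U hadeg (hkab.mono fun n hn => hn.2.2.2.2.2.2.1)
  obtain ⟨B, hB⟩ := exists_tendsto_coeff U hbdeg (hkab.mono fun n hn => hn.2.2.2.2.2.2.2)
  have hlim_ne_zero : ∀ {p : ι → MvPolynomial (Fin ℓ) ℂ} {q : MvPolynomial (Fin ℓ) ℂ},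
      (∀ d, Tendsto (fun n => coeff d (p n)) U (𝓝 (coeff d q))) →
      (∃ d, ∀ᶠ n in U, coeff d (p n) = 1) → q ≠ 0 := by
    rintro p q hpq ⟨d, hd⟩ rfl
    have h1 : Tendsto (fun n => coeff d (p n)) U (𝓝 1) :=
      tendsto_const_nhds.congr' (hd.mono fun n hn => hn.symm)
    simpa using tendsto_nhds_unique h1 (hpq d)
  have hA0 : A ≠ 0 := hlim_ne_zero hA
    (U.exists_eventually_coeff_eq_one hadeg (hkab.mono fun n hn => hn.2.2.2.2.1))
  have hB0 : B ≠ 0 := hlim_ne_zero hB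
    (U.exists_eventually_coeff_eq_one hbdeg (hkab.mono fun n hn => hn.2.2.2.2.2.1))
  have hAB := tendsto_coeff_mul hA hB
  obtain ⟨e, he⟩ := ne_zero_iff.1 (mul_ne_zero hA0 hB0)
  have hk : Tendsto k U (𝓝 (coeff e f / coeff e (A * B))) := by
    refine ((hlim e).div (hAB e) he).congr' ?_
    filter_upwards [hkab, (hAB e).eventually_ne he] with n hn hne
    rw [Pi.div_apply, hn.1, coeff_C_mul, mul_div_cancel_right₀ _ hne]
  set K := coeff e f / coeff e (A * B)
  have hfK : f = C K * (A * B) := by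
    ext d
    rw [coeff_C_mul]
    refine tendsto_nhds_unique (hlim d) ((hk.mul (hAB d)).congr' ?_)
    filter_upwards [hkab] with n hn
    rw [hn.1, coeff_C_mul]
  have hK0 : K ≠ 0 := by
    intro h
    exact hf.ne_zero (by rw [hfK, h, C_0, zero_mul])
  have hfdeg : ∀ i, f.degreeOf i = A.degreeOf i + B.degreeOf i := fun i => by
    rw [hfK, degreeOf_C_mul_of_ne_zero hK0, degreeOf_mul_eq hA0 hB0]
  obtain ⟨n, ⟨hn, hsum⟩, hAle, hBle⟩ := ((hkab.and hsum).and
    ((eventually_all.2 (eventually_degreeOf_le hA)).and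
      (eventually_all.2 (eventually_degreeOf_le hB)))).exists
  have hne_zero : ∀ {p : MvPolynomial (Fin ℓ) ℂ}, (∃ d, coeff d p = 1) → p ≠ 0 := by
    rintro p ⟨d, hd⟩ rfl
    simp at hd
  rcases hf.isUnit_or_isUnit (hfK.trans (mul_assoc _ _ _).symm) with hu | hu
  · refine hn.2.1 (isUnit_of_degreeOf_eq_zero (hne_zero hn.2.2.2.2.1) fun i => ?_)
    have := degreeOf_eq_zero_of_isUnit (isUnit_of_mul_isUnit_right hu) i
    have := hfdeg i
    have := hsum i
    have := hBle i
    omega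
  · refine hn.2.2.1 (isUnit_of_degreeOf_eq_zero (hne_zero hn.2.2.2.2.2.1) fun i => ?_)
    have := degreeOf_eq_zero_of_isUnit hu i
    have := hfdeg i
    have := hsum i
    have := hAle i
    omega

/-- The set `{f ∈ ℙ^m : deg f = m and f irreducible}` is open in `ℙ^m` (with the topology
induced by the coefficient norm): every such `f` has a ball in `ℙ^m` around it consisting
of polynomials of exact degree `m` which are irreducible. -/
theorem isOpen_irreducible_of_degree_eq (ℓ : ℕ) (hl : 1 ≤ ℓ) (m : Fin ℓ → ℕ) :
    ∀ f : MvPolynomial (Fin ℓ) ℂ, (∀ i, f.degreeOf i ≤ m i) →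
      (∀ i, f.degreeOf i = m i) → Irreducible f →
      ∃ δ : ℝ, 0 < δ ∧ ∀ g : MvPolynomial (Fin ℓ) ℂ, (∀ i, g.degreeOf i ≤ m i) →
        pNorm (g - f) < δ → (∀ i, g.degreeOf i = m i) ∧ Irreducible g := by
  intro f _ hfm hf
  have key : ∀ᶠ g : MvPolynomial (Fin ℓ) ℂ in
      comap (fun g => pNorm (g - f)) (𝓝 0) ⊓ 𝓟 {g | ∀ i, g.degreeOf i ≤ m i},
      (∀ i, g.degreeOf i = m i) ∧ Irreducible g := by
    refine mem_iff_ultrafilter.2 fun U hU => ?_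
    have hlim : ∀ d, Tendsto (fun g => coeff d g) U (𝓝 (coeff d f)) := fun d => by
      rw [tendsto_iff_norm_sub_tendsto_zero]
      refine squeeze_zero (fun _ => norm_nonneg _) (fun g => ?_)
        (tendsto_comap.mono_left (hU.trans inf_le_left))
      rw [← coeff_sub]
      exact norm_coeff_le_pNorm _ _
    have hle : ∀ᶠ g : MvPolynomial (Fin ℓ) ℂ in U, ∀ i, g.degreeOf i ≤ m i :=
      le_principal_iff.1 (hU.trans inf_le_right)
    have hdeg : ∀ᶠ g : MvPolynomial (Fin ℓ) ℂ in U, ∀ i, g.degreeOf i = m i := by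
      filter_upwards [hle, eventually_all.2 (eventually_degreeOf_le hlim)] with g hg hge i
      exact (hg i).antisymm (hfm i ▸ hge i)
    refine hdeg.and (eventually_irreducible U hf ?_ hlim)
    simpa only [hfm] using hdeg
  obtain ⟨δ, hδ, h⟩ := ((Metric.nhds_basis_ball.comap _).inf_principal _).eventually_iff.1 key
  refine ⟨δ, hδ, fun g hg hgf => h ⟨?_, hg⟩⟩
  simpa [abs_of_nonneg (show 0 ≤ pNorm (g - f) from Real.sqrt_nonneg _)] using hgf
end

section
/- Let n ≥ 1. In the finite-dimensional ℂ-vector space V := {f ∈ ℂ[X] : degree f ≤ n} with its canonical topology, the set {f ∈ V : natDegree f = n and f is squarefree} is open and dense in V. -/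
open scoped Classical

/-- The Hermitian inner product on coefficients of univariate polynomials
(conjugate-linear in the first argument). -/
noncomputable def qInner (p q : Polynomial ℂ) : ℂ :=
  ∑ i ∈ p.support ∪ q.support, (starRingEnd ℂ) (p.coeff i) * q.coeff i

/-- The coefficient norm `‖p‖ := √⟪p,p⟫`. -/
noncomputable def qNorm (p : Polynomial ℂ) : ℝ :=
  Real.sqrt (qInner p p).re

section

open Polynomial

/-- A polynomial of degree at most `n ≥ 1` over a field of characteristic zero is
squarefree of exact degree `n` if and only if this expression in its coefficients does not vanish. -/
noncomputable def degreeDiscr {R : Type*} [CommRing R] (n : ℕ) (f : R[X]) : R :=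
  f.coeff n * f.resultant (derivative f) n (n - 1)

theorem degreeDiscr_map {R S : Type*} [CommRing R] [CommRing S] (φ : R →+* S) (n : ℕ) (f : R[X]) :
    degreeDiscr n (f.map φ) = φ (degreeDiscr n f) := by
  rw [degreeDiscr, degreeDiscr, derivative_map, resultant_map_map, coeff_map, map_mul]

theorem degreeDiscr_ne_zero_iff {K : Type*} [Field K] [CharZero K] {n : ℕ} (hn : 1 ≤ n) {f : K[X]}
    (hf : f.degree ≤ n) : degreeDiscr n f ≠ 0 ↔ f.natDegree = n ∧ Squarefree f := by
  by_cases hdeg : f.natDegree = n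
  · have hf0 : f ≠ 0 := by
      rintro rfl
      simp at hdeg
      omega
    have hcoeff : f.coeff n ≠ 0 := by simpa [← hdeg] using hf0
    have hder : (derivative f).natDegree = n - 1 := by
      rw [natDegree_derivative, hdeg]
    have hres : f.resultant (derivative f) n (n - 1) = f.resultant (derivative f) := by
      rw [hder, hdeg]
    rw [degreeDiscr, hres, mul_ne_zero_iff, ← PerfectField.separable_iff_squarefree, Separable,
      Ne, Ne, resultant_eq_zero_iff]
    simp [hcoeff, hdeg, hf0]
  · have hcoeff : f.coeff n = 0 :=
      coeff_eq_zero_of_natDegree_lt (lt_of_le_of_ne (natDegree_le_of_degree_le hf) hdeg)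
    simp [degreeDiscr, hcoeff, hdeg]

theorem continuous_degreeDiscr {R ι : Type*} [CommRing R] [TopologicalSpace R]
    [IsTopologicalRing R] [TopologicalSpace ι] (n : ℕ) (P : ι → R[X])
    (hP : ∀ i, Continuous fun c => (P c).coeff i) :
    Continuous fun c => degreeDiscr n (P c) := by
  unfold degreeDiscr resultant
  refine (hP n).mul (Continuous.matrix_det (continuous_matrix fun i j => ?_))
  have hP' : ∀ i, Continuous fun c => (derivative (P c)).coeff i := fun i => by
    simp only [coeff_derivative]
    exact (hP (i + 1)).mul continuous_const
  induction j using Fin.addCases <;> simp only [sylvester, Matrix.of_apply, Fin.addCases_left,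
    Fin.addCases_right] <;> split_ifs <;> first | exact continuous_const | exact hP _ | exact hP' _

theorem qNorm_eq {n : ℕ} {p : ℂ[X]} (hp : p.degree ≤ n) :
    qNorm p = √(∑ i ∈ Finset.range (n + 1), ‖p.coeff i‖ ^ 2) := by
  rw [qNorm, qInner, Finset.union_self]
  have hterm : ∀ i, (starRingEnd ℂ (p.coeff i) * p.coeff i) = ((‖p.coeff i‖ ^ 2 : ℝ) : ℂ) :=
    fun i => by rw [Complex.conj_mul']; norm_cast
  simp_rw [hterm, ← Complex.ofReal_sum, Complex.ofReal_re]
  congr 1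
  refine Finset.sum_subset (fun i hi => ?_) (fun i _ hi => ?_)
  · exact Finset.mem_range_succ_iff.2 ((le_natDegree_of_mem_supp i hi).trans
      (natDegree_le_of_degree_le hp))
  · simp [notMem_support_iff.1 hi]

theorem norm_coeff_le_qNorm (p : ℂ[X]) (i : ℕ) : ‖p.coeff i‖ ≤ qNorm p := by
  rcases lt_or_ge p.natDegree i with hi | hi
  · rw [coeff_eq_zero_of_natDegree_lt hi, norm_zero]
    exact Real.sqrt_nonneg _
  · rw [qNorm_eq degree_le_natDegree]
    exact Real.le_sqrt_of_sq_le (Finset.single_le_sum (f := fun j => ‖p.coeff j‖ ^ 2)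
      (fun j _ => sq_nonneg _) (Finset.mem_range_succ_iff.2 hi))

theorem qNorm_C_mul (t : ℂ) (p : ℂ[X]) : qNorm (C t * p) = ‖t‖ * qNorm p := by
  have hdeg : (C t * p).degree ≤ p.natDegree :=
    degree_le_of_natDegree_le (natDegree_C_mul_le t p)
  rw [qNorm_eq hdeg, qNorm_eq degree_le_natDegree]
  simp_rw [coeff_C_mul, norm_mul, mul_pow, ← Finset.mul_sum]
  rw [Real.sqrt_mul (sq_nonneg _), Real.sqrt_sq (norm_nonneg _)]

theorem exists_forall_qNorm_sub_lt_degreeDiscr_ne_zero {n : ℕ} {f : ℂ[X]} (hf : f.degree ≤ n)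
    (hf0 : degreeDiscr n f ≠ 0) :
    ∃ δ : ℝ, 0 < δ ∧ ∀ g : ℂ[X], g.degree ≤ n → qNorm (g - f) < δ → degreeDiscr n g ≠ 0 := by
  let P : (Fin (n + 1) → ℂ) → ℂ[X] := fun c => ∑ i : Fin (n + 1), C (c i) * X ^ (i : ℕ)
  have hP : ∀ g : ℂ[X], g.degree ≤ n → P (fun i => g.coeff i) = g := fun g hg => by
    simp only [P, Fin.sum_univ_eq_sum_range (fun i => C (g.coeff i) * X ^ i) (n + 1),
      ← as_sum_range_C_mul_X_pow' g (Nat.lt_succ_of_le (natDegree_le_of_degree_le hg))]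
  have hcont : Continuous fun c => degreeDiscr n (P c) := by
    refine continuous_degreeDiscr n P fun i => ?_
    simp only [P, finsetSum_coeff, coeff_C_mul]
    fun_prop
  obtain ⟨δ, hδ, hball⟩ := Metric.isOpen_iff.1 (isOpen_ne.preimage hcont)
    (fun i => f.coeff i) (by simpa [hP f hf] using hf0)
  refine ⟨δ, hδ, fun g hg hgf => ?_⟩
  rw [← hP g hg]
  refine hball ((dist_pi_lt_iff hδ).2 fun i => ?_)
  rw [dist_eq_norm, ← coeff_sub]
  exact (norm_coeff_le_qNorm _ _).trans_lt hgf

theorem exists_qNorm_sub_lt_degreeDiscr_ne_zero {n : ℕ} {f h : ℂ[X]} (hf : f.degree ≤ n)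
    (hh : h.degree ≤ n) (hh0 : degreeDiscr n h ≠ 0) {ε : ℝ} (hε : 0 < ε) :
    ∃ g : ℂ[X], g.degree ≤ n ∧ degreeDiscr n g ≠ 0 ∧ qNorm (f - g) < ε := by
  let r : ℂ[X] := degreeDiscr n (f.map C + C X * (h - f).map C)
  have hr : ∀ t, r.eval t = degreeDiscr n (f + C t * (h - f)) := fun t => by
    rw [← coe_evalRingHom, ← degreeDiscr_map]
    have hid : (evalRingHom t).comp C = RingHom.id ℂ := by ext; simp
    simp only [Polynomial.map_add, Polynomial.map_mul, map_map, hid, map_id, map_C,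
      coe_evalRingHom, eval_X]
  have hr0 : r ≠ 0 := by
    intro h0
    apply hh0
    simpa [h0] using (hr 1).symm
  have hdense : Dense ((r.roots.toFinset : Set ℂ)ᶜ) :=
    (Finset.countable_toSet _).dense_compl ℂ
  have hq : 0 < qNorm (h - f) + 1 := add_pos_of_nonneg_of_pos (Real.sqrt_nonneg _) one_pos
  obtain ⟨t, ht, htr⟩ := hdense.exists_dist_lt 0 (div_pos hε hq)
  refine ⟨f + C t * (h - f), ?_, ?_, ?_⟩
  · refine (degree_add_le _ _).trans (max_le hf ?_)
    rw [← smul_eq_C_mul]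
    exact (degree_smul_le _ _).trans ((degree_sub_le _ _).trans (max_le hh hf))
  · rw [← hr]
    simpa [hr0] using ht
  · rw [dist_zero_left, lt_div_iff₀ hq] at htr
    have hsub : f - (f + C t * (h - f)) = C (-t) * (h - f) := by
      rw [C_neg]
      ring
    rw [hsub, qNorm_C_mul, norm_neg]
    exact (mul_le_mul_of_nonneg_left (le_add_of_nonneg_right zero_le_one)
      (norm_nonneg t)).trans_lt htr

theorem degreeDiscr_X_pow_sub_one_ne_zero {n : ℕ} (hn : 1 ≤ n) :
    degreeDiscr n (X ^ n - 1 : ℂ[X]) ≠ 0 := by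
  have hdeg : (X ^ n - 1 : ℂ[X]).natDegree = n := natDegree_X_pow_sub_C (r := 1)
  refine (degreeDiscr_ne_zero_iff hn (degree_le_of_natDegree_le hdeg.le)).2 ⟨hdeg, ?_⟩
  exact (separable_X_pow_sub_C (1 : ℂ) (Nat.cast_ne_zero.2 (by omega)) one_ne_zero).squarefree

end

/-- In the space `V = {f ∈ ℂ[X] : degree f ≤ n}` (with its canonical topology, induced by
the coefficient norm), the set `{f ∈ V : natDegree f = n and f squarefree}` is open and
dense: openness and density are stated via the metric. -/
theorem isOpen_dense_squarefree_degree_eq (n : ℕ) (hn : 1 ≤ n) :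
    (∀ f : Polynomial ℂ, f.degree ≤ (n : ℕ) → f.natDegree = n → Squarefree f →
      ∃ δ : ℝ, 0 < δ ∧ ∀ g : Polynomial ℂ, g.degree ≤ (n : ℕ) →
        qNorm (g - f) < δ → g.natDegree = n ∧ Squarefree g) ∧
    (∀ f : Polynomial ℂ, f.degree ≤ (n : ℕ) → ∀ ε : ℝ, 0 < ε →
      ∃ g : Polynomial ℂ, g.degree ≤ (n : ℕ) ∧ g.natDegree = n ∧ Squarefree g ∧
        qNorm (f - g) < ε) := by
  refine ⟨fun f hf hdeg hsq => ?_, fun f hf ε hε => ?_⟩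
  · obtain ⟨δ, hδ, hball⟩ := exists_forall_qNorm_sub_lt_degreeDiscr_ne_zero hf
      ((degreeDiscr_ne_zero_iff hn hf).2 ⟨hdeg, hsq⟩)
    exact ⟨δ, hδ, fun g hg hgf => (degreeDiscr_ne_zero_iff hn hg).1 (hball g hg hgf)⟩
  · have hX : (Polynomial.X ^ n - 1 : Polynomial ℂ).degree ≤ n :=
      Polynomial.degree_le_of_natDegree_le (Polynomial.natDegree_X_pow_sub_C (r := 1)).le
    obtain ⟨g, hg, hg0, hgf⟩ := exists_qNorm_sub_lt_degreeDiscr_ne_zero hf hX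
      (degreeDiscr_X_pow_sub_one_ne_zero hn) hε
    obtain ⟨hdeg, hsq⟩ := (degreeDiscr_ne_zero_iff hn hg).1 hg0
    exact ⟨g, hg, hdeg, hsq, hgf⟩
end

section
/- Let m ∈ ℕ^ℓ have at least two distinct indices i with m_i > 0 (a non-univariate degree). Then the set {f ∈ ℙ^m : deg f = m and f is irreducible in R} is dense in ℙ^m. -/
open scoped Classical

open MvPolynomial

/-- Every factorization `a + b` of a non-univariate degree into nonzero parts leaves a gap in the
parameter count. -/
lemma card_Iio_add_card_Iic_lt {σ : Type*} [Fintype σ] {a b : σ →₀ ℕ} (ha : a ≠ 0) (hb : b ≠ 0)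
    (hab : ∃ i j : σ, i ≠ j ∧ 0 < (a + b) i ∧ 0 < (a + b) j) :
    Fintype.card (Set.Iio a) + Fintype.card (Set.Iic b) < Fintype.card (Set.Iic (a + b)) := by
  have gap : ∃ i j : σ, i ≠ j ∧ 0 < a i ∧ 0 < b j := by
    by_contra! h
    obtain ⟨i, hi⟩ := Finsupp.ne_iff.mp ha
    obtain ⟨j, hj⟩ := Finsupp.ne_iff.mp hb
    obtain ⟨k, l, hkl, hk, hl⟩ := hab
    simp only [Finsupp.coe_zero, Pi.zero_apply, Finsupp.add_apply] at hi hj hk hl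
    have hij : i = j := by
      by_contra hne
      have := h i j hne (by omega)
      omega
    subst hij
    have off : ∀ t, t ≠ i → a t + b t = 0 := by
      intro t ht
      have h1 := h i t ht.symm (by omega)
      have h2 := h t i ht
      omega
    have hki : k = i := by
      by_contra hne
      have := off k hne
      omega
    have := off l (by rintro rfl; exact hkl hki)
    omega
  obtain ⟨i, j, hij, hi, hj⟩ := gap
  let φ : Set.Iio a ⊕ Set.Iic b → Set.Iic (a + b) :=
    Sum.elim (fun x => ⟨x.1, Set.mem_Iic.2 ((Set.mem_Iio.1 x.2).le.trans le_self_add)⟩)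
      (fun y => ⟨a + y.1, Set.mem_Iic.2 (add_le_add le_rfl y.2)⟩)
  rw [← Fintype.card_sum]
  have hle : Finsupp.single j (a j + b j) ≤ a + b := by
    rw [Finsupp.single_le_iff]
    rfl
  refine Fintype.card_lt_of_injective_of_notMem φ ?_ (b := ⟨_, hle⟩) ?_
  · rintro (⟨x, hx⟩ | ⟨x, hx⟩) (⟨y, hy⟩ | ⟨y, hy⟩) h
    · simpa [φ] using h
    · simp only [φ, Sum.elim_inl, Sum.elim_inr, Subtype.mk.injEq] at h
      subst h
      exact absurd (Set.mem_Iio.1 hx) (not_lt_of_ge le_self_add)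
    · simp only [φ, Sum.elim_inl, Sum.elim_inr, Subtype.mk.injEq] at h
      subst h
      exact absurd (Set.mem_Iio.1 hy) (not_lt_of_ge le_self_add)
    · simpa [φ] using h
  · rintro ⟨⟨x, hx⟩ | ⟨x, hx⟩, h⟩
    · replace h : x = Finsupp.single j (a j + b j) := congrArg Subtype.val h
      have := (Set.mem_Iio.1 hx).le j
      rw [h, Finsupp.single_eq_same] at this
      omega
    · replace h : a + x = Finsupp.single j (a j + b j) := congrArg Subtype.val h
      have := DFunLike.congr_fun h i
      rw [Finsupp.add_apply, Finsupp.single_eq_of_ne hij] at this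
      omega

lemma finrank_real_pi_complex (ι : Type*) [Fintype ι] :
    Module.finrank ℝ (ι → ℂ) = 2 * Fintype.card ι := by
  rw [Module.finrank_pi_fintype]
  simp [Complex.finrank_real_complex, mul_comm]

/-- Extend coefficients below `a` to a coefficient family with coefficient `t` at `a` and zero
outside the box of `a`. -/
noncomputable def extendBelow {σ : Type*} (a : σ →₀ ℕ) (t : ℂ) (u : Set.Iio a → ℂ)
    (e : σ →₀ ℕ) : ℂ :=
  if h : e ∈ Set.Iio a then u ⟨e, h⟩ else if e = a then t else 0

/-- Extend coefficients in the box of `b` by zero. -/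
noncomputable def extendBox {σ : Type*} (b : σ →₀ ℕ) (v : Set.Iic b → ℂ) (e : σ →₀ ℕ) : ℂ :=
  if h : e ∈ Set.Iic b then v ⟨e, h⟩ else 0

/-- Coefficients in the box of `m` of the product of a polynomial with leading monomial `a` and
leading coefficient one, and a polynomial in the box of `b`. -/
noncomputable def mulCoeff {σ : Type*} (a b m : σ →₀ ℕ)
    (x : (Set.Iio a → ℂ) × (Set.Iic b → ℂ)) (d : Set.Iic m) : ℂ :=
  ∑ e ∈ Finset.HasAntidiagonal.antidiagonal d.1, extendBelow a 1 x.1 e.1 * extendBox b x.2 e.2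

lemma contDiff_extendBelow {σ : Type*} [Fintype σ] (a : σ →₀ ℕ) (t : ℂ) (e : σ →₀ ℕ) :
    ContDiff ℝ 1 fun u : Set.Iio a → ℂ => extendBelow a t u e := by
  unfold extendBelow
  split_ifs <;> fun_prop

lemma contDiff_extendBox {σ : Type*} [Fintype σ] (b : σ →₀ ℕ) (e : σ →₀ ℕ) :
    ContDiff ℝ 1 fun v : Set.Iic b → ℂ => extendBox b v e := by
  unfold extendBox
  split_ifs <;> fun_prop

lemma contDiff_mulCoeff {σ : Type*} [Fintype σ] (a b m : σ →₀ ℕ) :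
    ContDiff ℝ 1 (mulCoeff a b m) := by
  refine contDiff_pi.2 fun d => ContDiff.sum fun e _ => ContDiff.mul ?_ ?_
  · exact (contDiff_extendBelow a 1 e.1).comp contDiff_fst
  · exact (contDiff_extendBox b e.2).comp contDiff_snd

/-- Coefficient families in the box of `m` which have vanishing top coefficient or come from a
product of polynomials of smaller nonzero degrees. -/
def degenerateCoeffs {σ : Type*} (m : σ →₀ ℕ) : Set (Set.Iic m → ℂ) :=
  Set.range (fun u : Set.Iio m → ℂ => fun d : Set.Iic m => extendBelow m 0 u d.1) ∪
    ⋃ x ∈ {x : (σ →₀ ℕ) × (σ →₀ ℕ) | x.1 + x.2 = m ∧ x.1 ≠ 0 ∧ x.2 ≠ 0},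
      Set.range (mulCoeff x.1 x.2 m)

lemma dense_compl_degenerateCoeffs {σ : Type*} [Fintype σ] {m : σ →₀ ℕ}
    (hm : ∃ i j : σ, i ≠ j ∧ 0 < m i ∧ 0 < m j) : Dense (degenerateCoeffs m)ᶜ := by
  apply dense_compl_of_dimH_lt_finrank
  have hcard : Fintype.card (Set.Iio m) < Fintype.card (Set.Iic m) :=
    Set.card_lt_card Set.Iio_ssubset_Iic_self
  have hlt : 2 * Fintype.card (Set.Iic m) - 1 < Module.finrank ℝ (Set.Iic m → ℂ) := by
    rw [finrank_real_pi_complex]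
    omega
  refine lt_of_le_of_lt ?_ (Nat.cast_lt.2 hlt)
  rw [degenerateCoeffs, dimH_union, dimH_bUnion (Set.to_countable _)]
  refine max_le ?_ (iSup₂_le fun x hx => ?_)
  · refine (ContDiff.dimH_range_le
      (contDiff_pi.2 fun d : Set.Iic m => contDiff_extendBelow m 0 d.1)).trans ?_
    rw [Nat.cast_le, finrank_real_pi_complex]
    omega
  · obtain ⟨rfl, ha, hb⟩ := hx
    refine (contDiff_mulCoeff _ _ _).dimH_range_le.trans ?_
    have := card_Iio_add_card_Iic_lt ha hb hm
    rw [Nat.cast_le, Module.finrank_prod, finrank_real_pi_complex, finrank_real_pi_complex]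
    omega

/-- The multidegree of a polynomial. -/
noncomputable def multidegree {σ : Type*} [Fintype σ] (p : MvPolynomial σ ℂ) : σ →₀ ℕ :=
  Finsupp.equivFunOnFinite.symm fun i => p.degreeOf i

lemma coeff_eq_zero_of_not_le_multidegree {σ : Type*} [Fintype σ] {p : MvPolynomial σ ℂ}
    {d : σ →₀ ℕ} (h : ¬ d ≤ multidegree p) : coeff d p = 0 := by
  by_contra hd
  exact h fun i => monomial_le_degreeOf i (mem_support_iff.2 hd)

lemma multidegree_ne_zero {σ : Type*} [Fintype σ] {p : MvPolynomial σ ℂ} (h0 : p ≠ 0)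
    (hu : ¬ IsUnit p) : multidegree p ≠ 0 := by
  intro h
  have hp : p = C (coeff 0 p) := by
    ext d
    rw [coeff_C]
    split_ifs with hd
    · rw [hd]
    · refine coeff_eq_zero_of_not_le_multidegree fun hle => hd ?_
      rw [h] at hle
      exact (le_antisymm hle zero_le).symm
  refine hu ?_
  rw [hp]
  refine IsUnit.map C (isUnit_iff_ne_zero.2 fun hc => h0 ?_)
  rw [hp, hc, C_0]

lemma multidegree_mul {σ : Type*} [Fintype σ] {p q : MvPolynomial σ ℂ} (hp : p ≠ 0)
    (hq : q ≠ 0) : multidegree (p * q) = multidegree p + multidegree q := by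
  ext i
  exact degreeOf_mul_eq hp hq

lemma coeff_multidegree_add {σ : Type*} [Fintype σ] (p q : MvPolynomial σ ℂ) :
    coeff (multidegree p + multidegree q) (p * q) =
      coeff (multidegree p) p * coeff (multidegree q) q := by
  rw [coeff_mul]
  refine Finset.sum_eq_single (multidegree p, multidegree q) ?_ (by simp)
  rintro ⟨x, y⟩ hxy hne
  rw [Finset.HasAntidiagonal.mem_antidiagonal] at hxy
  by_cases hx : x ≤ multidegree p
  · by_cases hy : y ≤ multidegree q
    · refine absurd ?_ hne
      have := (add_eq_add_iff_eq_and_eq hx hy).1 hxy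
      exact Prod.ext this.1 this.2
    · simp [coeff_eq_zero_of_not_le_multidegree hy]
  · simp [coeff_eq_zero_of_not_le_multidegree hx]

lemma coeff_mul_mem_range_mulCoeff {σ : Type*} [Fintype σ] (m : σ →₀ ℕ)
    {p q : MvPolynomial σ ℂ} (hc : coeff (multidegree p) p ≠ 0) :
    (fun d : Set.Iic m => coeff d.1 (p * q)) ∈
      Set.range (mulCoeff (multidegree p) (multidegree q) m) := by
  set c := coeff (multidegree p) p with hc_def
  refine ⟨(fun e => c⁻¹ * coeff e.1 p, fun e => c * coeff e.1 q), funext fun d => ?_⟩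
  rw [mulCoeff, coeff_mul]
  refine Finset.sum_congr rfl fun e _ => ?_
  have h1 : extendBelow (multidegree p) 1 (fun e => c⁻¹ * coeff e.1 p) e.1 =
      c⁻¹ * coeff e.1 p := by
    unfold extendBelow
    split_ifs with h h'
    · rfl
    · rw [h', ← hc_def, inv_mul_cancel₀ hc]
    · rw [coeff_eq_zero_of_not_le_multidegree fun hle => h (lt_of_le_of_ne hle h'), mul_zero]
  have h2 : extendBox (multidegree q) (fun e => c * coeff e.1 q) e.2 = c * coeff e.2 q := by
    unfold extendBox
    split_ifs with h
    · rfl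
    · rw [coeff_eq_zero_of_not_le_multidegree h, mul_zero]
  rw [h1, h2]
  field_simp

/-- The polynomial with given coefficients in the box of `m`. -/
noncomputable def ofBoxCoeffs {σ : Type*} [Fintype σ] (m : σ →₀ ℕ) (c : Set.Iic m → ℂ) :
    MvPolynomial σ ℂ :=
  ∑ d : Set.Iic m, monomial d.1 (c d)

lemma coeff_ofBoxCoeffs {σ : Type*} [Fintype σ] (m : σ →₀ ℕ) (c : Set.Iic m → ℂ)
    (e : σ →₀ ℕ) : coeff e (ofBoxCoeffs m c) = extendBox m c e := by
  rw [ofBoxCoeffs, coeff_sum, extendBox]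
  simp only [coeff_monomial]
  split_ifs with h
  · rw [Finset.sum_eq_single ⟨e, h⟩]
    · simp
    · intro d _ hd
      exact if_neg fun he => hd (Subtype.ext he)
    · simp
  · exact Finset.sum_eq_zero fun d _ => if_neg fun he : d.1 = e => h (he ▸ d.2)

lemma coeff_top_ne_zero {σ : Type*} {m : σ →₀ ℕ} {c : Set.Iic m → ℂ}
    (hc : c ∉ degenerateCoeffs m) : c ⟨m, Set.mem_Iic.2 le_rfl⟩ ≠ 0 := by
  intro h0
  refine hc (Or.inl ⟨fun d => c ⟨d.1, Set.Iio_subset_Iic_self d.2⟩, funext fun d => ?_⟩)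
  obtain ⟨d, hd⟩ := d
  rcases lt_or_eq_of_le (Set.mem_Iic.1 hd) with h | rfl
  · simp [extendBelow, h]
  · simp [extendBelow, h0]

lemma multidegree_ofBoxCoeffs {σ : Type*} [Fintype σ] {m : σ →₀ ℕ} {c : Set.Iic m → ℂ}
    (hc : c ∉ degenerateCoeffs m) : multidegree (ofBoxCoeffs m c) = m := by
  refine le_antisymm (fun i => ?_) ?_
  · refine (degreeOf_le_iff).2 fun d hd => ?_
    rw [mem_support_iff, coeff_ofBoxCoeffs] at hd
    by_contra h
    exact hd (dif_neg fun hle => h (hle i))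
  · by_contra h
    have := coeff_eq_zero_of_not_le_multidegree h
    rw [coeff_ofBoxCoeffs, extendBox, dif_pos (Set.mem_Iic.2 le_rfl)] at this
    exact coeff_top_ne_zero hc this

lemma irreducible_ofBoxCoeffs {σ : Type*} [Fintype σ] {m : σ →₀ ℕ} (hm : m ≠ 0)
    {c : Set.Iic m → ℂ} (hc : c ∉ degenerateCoeffs m) : Irreducible (ofBoxCoeffs m c) := by
  have hdeg := multidegree_ofBoxCoeffs hc
  have htop : coeff m (ofBoxCoeffs m c) ≠ 0 := by
    rw [coeff_ofBoxCoeffs, extendBox, dif_pos (Set.mem_Iic.2 le_rfl)]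
    exact coeff_top_ne_zero hc
  have hne : ofBoxCoeffs m c ≠ 0 := by
    intro h
    simp [h] at htop
  refine ⟨fun hu => hm ?_, fun p q hpq => ?_⟩
  · obtain ⟨r, _, hr⟩ := isUnit_iff_eq_C_of_isReduced.1 hu
    rw [← hdeg, hr]
    ext i
    exact degreeOf_C r i
  · by_contra! h
    have hp : p ≠ 0 := by rintro rfl; simp [hpq] at hne
    have hq : q ≠ 0 := by rintro rfl; simp [hpq] at hne
    have hadd : multidegree p + multidegree q = m := by
      rw [← multidegree_mul hp hq, ← hpq, hdeg]
    have hlead : coeff (multidegree p) p ≠ 0 := by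
      rw [hpq, ← hadd, coeff_multidegree_add] at htop
      exact left_ne_zero_of_mul htop
    refine hc (Or.inr (Set.mem_biUnion (x := (multidegree p, multidegree q))
      ⟨hadd, multidegree_ne_zero hp h.1, multidegree_ne_zero hq h.2⟩ ?_))
    convert coeff_mul_mem_range_mulCoeff m (q := q) hlead using 1
    funext d
    rw [← hpq, coeff_ofBoxCoeffs, extendBox, dif_pos d.2]

lemma pNorm_eq_sqrt_sum {ℓ : ℕ} {m : Fin ℓ →₀ ℕ} {p : MvPolynomial (Fin ℓ) ℂ}
    (hp : ∀ d, ¬ d ≤ m → coeff d p = 0) :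
    pNorm p = √(∑ d : Set.Iic m, ‖coeff d.1 p‖ ^ 2) := by
  have hsub : p.support ∪ p.support ⊆ Finset.Iic m := by
    intro d hd
    rw [Finset.union_self, mem_support_iff] at hd
    rw [Finset.mem_Iic]
    by_contra h
    exact hd (hp d h)
  rw [pNorm, pInner, Finset.sum_subset hsub, Complex.re_sum]
  · congr 1
    rw [← Finset.sum_subtype (Finset.Iic m) (p := (· ∈ Set.Iic m)) (by simp)
      (fun d => ‖coeff d p‖ ^ 2)]
    refine Finset.sum_congr rfl fun d _ => ?_
    rw [Complex.conj_mul', ← Complex.ofReal_pow, Complex.ofReal_re]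
  · intro d _ hd
    rw [Finset.union_self, notMem_support_iff] at hd
    rw [hd, mul_zero]

/-- For a non-univariate degree `m` (at least two distinct indices `i` with `m_i > 0`),
the set `{f ∈ ℙ^m : deg f = m and f irreducible}` is dense in `ℙ^m` (with the topology
induced by the coefficient norm). -/
theorem dense_irreducible_of_degree_eq (ℓ : ℕ) (hl : 1 ≤ ℓ) (m : Fin ℓ → ℕ)
    (hm : ∃ i j : Fin ℓ, i ≠ j ∧ 0 < m i ∧ 0 < m j) :
    ∀ f : MvPolynomial (Fin ℓ) ℂ, (∀ i, f.degreeOf i ≤ m i) → ∀ ε : ℝ, 0 < ε →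
      ∃ g : MvPolynomial (Fin ℓ) ℂ, (∀ i, g.degreeOf i = m i) ∧ Irreducible g ∧
        pNorm (f - g) < ε := by
  intro f hf ε hε
  set M : Fin ℓ →₀ ℕ := Finsupp.equivFunOnFinite.symm m
  have hM0 : M ≠ 0 := by
    obtain ⟨i, -, -, hi, -⟩ := hm
    intro h
    have : m i = 0 := DFunLike.congr_fun h i
    omega
  let U : Set (Set.Iic M → ℂ) := {c | √(∑ d : Set.Iic M, ‖coeff d.1 f - c d‖ ^ 2) < ε}
  have hU : IsOpen U := isOpen_lt (by fun_prop) continuous_const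
  have hUne : U.Nonempty := ⟨fun d => coeff d.1 f, by simpa [U] using hε⟩
  obtain ⟨c, hcU, hc⟩ := (dense_compl_degenerateCoeffs (m := M) hm).inter_open_nonempty U hU hUne
  refine ⟨ofBoxCoeffs M c, fun i => DFunLike.congr_fun (multidegree_ofBoxCoeffs hc) i,
    irreducible_ofBoxCoeffs hM0 hc, ?_⟩
  have hbox : ∀ d, ¬ d ≤ M → coeff d (f - ofBoxCoeffs M c) = 0 := by
    intro d hd
    rw [coeff_sub, coeff_ofBoxCoeffs, extendBox, dif_neg (mt Set.mem_Iic.1 hd), sub_zero]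
    exact coeff_eq_zero_of_not_le_multidegree fun h => hd (h.trans hf)
  rw [pNorm_eq_sqrt_sum hbox]
  have hcoeff : ∀ d : Set.Iic M, coeff d.1 (f - ofBoxCoeffs M c) = coeff d.1 f - c d := by
    intro d
    rw [coeff_sub, coeff_ofBoxCoeffs, extendBox, dif_pos d.2]
  simp only [hcoeff]
  exact hcU
end

section
/- Let r ≥ 1, let m_1,…,m_r ∈ ℕ^ℓ, let p_j ∈ 𝒫^{m_j} for j = 1,…,r, let k_1,…,k_r ≥ 1 be integers, let α ∈ ℂ be nonzero, and for each j let φ_j : R → ℂ be a ℂ-linear map with φ_j(p_j) ≠ 0. Consider the following property (injectivity of the Jacobian of the factorization map): for all a ∈ ℂ and all v_1,…,v_r ∈ R satisfying (i) deg_i v_j ≤ (m_j)_i for all i and j, (ii) φ_j(v_j) = 0 for all j, and (iii) Σ_{j=1}^{r} k_j·α·v_j·∏_{t≠j} p_t = a·∏_{t=1}^{r} p_t, one has a = 0 and v_1 = ⋯ = v_r = 0. This property holds if and only if p_1,…,p_r are pairwise coprime, i.e. IsRelPrime p_i p_j (every common divisor of p_i and p_j is a unit) for all i ≠ j. -/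
open scoped Classical

namespace MvPolynomial

/-- A multiple of a nonzero polynomial `p` whose partial degrees do not exceed those of `p` is a
scalar multiple of `p`. -/
theorem exists_eq_C_mul_of_dvd_of_degreeOf_le {σ R : Type*} [CommRing R] [IsDomain R]
    {p v : MvPolynomial σ R} (hp : p ≠ 0) (hdvd : p ∣ v)
    (hle : ∀ t, v.degreeOf t ≤ p.degreeOf t) : ∃ c : R, v = C c * p := by
  obtain ⟨q, rfl⟩ := hdvd
  rcases eq_or_ne q 0 with rfl | hq
  · exact ⟨0, by simp⟩
  have hq0 : q.totalDegree = 0 := by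
    refine (totalDegree_eq_zero_iff _ _).2 fun m hm t => ?_
    have h := hle t
    rw [degreeOf_mul_eq hp hq] at h
    have := monomial_le_degreeOf t hm
    omega
  refine ⟨q.coeff 0, ?_⟩
  rw [mul_comm p, ← totalDegree_eq_zero_iff_eq_C.1 hq0]

theorem degreeOf_le_of_dvd_of_ne_zero {σ R : Type*} [CommRing R] [IsDomain R]
    {p q : MvPolynomial σ R} (hq : q ≠ 0) (hdvd : p ∣ q) (t : σ) :
    p.degreeOf t ≤ q.degreeOf t := by
  obtain ⟨s, rfl⟩ := hdvd
  rw [degreeOf_mul_eq (left_ne_zero_of_mul hq) (right_ne_zero_of_mul hq)]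
  exact Nat.le_add_right _ _

/-- If a nonzero scalar multiple of `s ≠ 0` is a scalar multiple of `g * s`, then `g` is a unit. -/
theorem isUnit_of_C_mul_sub_eq_zero {σ K : Type*} [Field K] {g s : MvPolynomial σ K} {c d : K}
    (hs : s ≠ 0) (hc : c ≠ 0) (h : C c * s - C d * (g * s) = 0) : IsUnit g := by
  have h1 : C d * g = C c := by
    refine mul_right_cancel₀ hs ?_
    linear_combination -h
  refine IsUnit.of_mul_eq_one (C (c⁻¹ * d)) ?_
  rw [C_mul, mul_comm, mul_assoc, h1, ← C_mul, inv_mul_cancel₀ hc, C_1]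

end MvPolynomial

theorem sum_mul_sub_mul_prod_erase {ι R : Type*} [Fintype ι] [DecidableEq ι] [CommRing R]
    (x w c p : ι → R) :
    ∑ n, x n * (w n - c n * p n) * ∏ t ∈ Finset.univ.erase n, p t =
      ∑ n, x n * w n * ∏ t ∈ Finset.univ.erase n, p t - (∑ n, x n * c n) * ∏ t, p t := by
  rw [Finset.sum_mul, ← Finset.sum_sub_distrib]
  refine Finset.sum_congr rfl fun n _ => ?_
  rw [← Finset.mul_prod_erase Finset.univ p (Finset.mem_univ n)]
  ring

/-- Injectivity of the Jacobian of the factorization map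
`(γ, q_1, …, q_r) ↦ (γ·q_1^{k_1}⋯q_r^{k_r}, φ_1(q_1), …, φ_r(q_r))` at `(α, p_1,…,p_r)`
holds if and only if `p_1,…,p_r` are pairwise coprime. -/
theorem jacobian_injective_iff_pairwise_coprime (ℓ : ℕ) (r : ℕ) (hr : 1 ≤ r)
    (mdeg : Fin r → Fin ℓ → ℕ) (p : Fin r → MvPolynomial (Fin ℓ) ℂ)
    (hdeg : ∀ j t, (p j).degreeOf t = mdeg j t)
    (k : Fin r → ℕ) (hk : ∀ j, 1 ≤ k j)
    (α : ℂ) (hα : α ≠ 0)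
    (φ : Fin r → (MvPolynomial (Fin ℓ) ℂ →ₗ[ℂ] ℂ))
    (hφ : ∀ j, φ j (p j) ≠ 0) :
    (∀ (a : ℂ) (v : Fin r → MvPolynomial (Fin ℓ) ℂ),
        (∀ j t, (v j).degreeOf t ≤ mdeg j t) →
        (∀ j, φ j (v j) = 0) →
        (∑ j, MvPolynomial.C ((k j : ℂ) * α) * v j * ∏ t ∈ Finset.univ.erase j, p t) =
          MvPolynomial.C a * ∏ t, p t →
        a = 0 ∧ ∀ j, v j = 0)
      ↔ (∀ i j : Fin r, i ≠ j → IsRelPrime (p i) (p j)) := by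
  have hp : ∀ j, p j ≠ 0 := fun j h => hφ j (by rw [h, map_zero])
  have hk0 : ∀ j, (k j : ℂ) ≠ 0 := fun j => Nat.cast_ne_zero.2 (by have := hk j; omega)
  constructor
  · intro H i j hij g hgi hgj
    obtain ⟨s, hs⟩ := hgi
    obtain ⟨u, hu⟩ := hgj
    have hs0 : s ≠ 0 := right_ne_zero_of_mul (hs ▸ hp i)
    -- the kernel element is `(k_j s, -k_i u)`, corrected by multiples of `p_i` and `p_j`
    -- so that the functionals vanish
    set w : Fin r → MvPolynomial (Fin ℓ) ℂ := fun n =>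
      if n = i then MvPolynomial.C (k j : ℂ) * s
      else if n = j then MvPolynomial.C (-(k i : ℂ)) * u else 0 with hw
    set c : Fin r → ℂ := fun n => φ n (w n) / φ n (p n) with hc
    set v : Fin r → MvPolynomial (Fin ℓ) ℂ := fun n => w n - MvPolynomial.C (c n) * p n with hv
    have hwi : w i = MvPolynomial.C (k j : ℂ) * s := by simp [hw]
    have hwj : w j = MvPolynomial.C (-(k i : ℂ)) * u := by simp [hw, hij.symm]
    have hw0 : ∀ n, n ≠ i ∧ n ≠ j → w n = 0 := fun n hn => by simp [hw, hn.1, hn.2]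
    have hwdeg : ∀ n t, (w n).degreeOf t ≤ (p n).degreeOf t := by
      intro n t
      by_cases hni : n = i
      · subst hni
        rw [hwi]
        exact (MvPolynomial.degreeOf_C_mul_le _ _ _).trans
          (MvPolynomial.degreeOf_le_of_dvd_of_ne_zero (hp n) (hs ▸ dvd_mul_left s g) t)
      by_cases hnj : n = j
      · subst hnj
        rw [hwj]
        exact (MvPolynomial.degreeOf_C_mul_le _ _ _).trans
          (MvPolynomial.degreeOf_le_of_dvd_of_ne_zero (hp n) (hu ▸ dvd_mul_left u g) t)
      simp [hw0 n ⟨hni, hnj⟩]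
    have hsum : ∑ n, MvPolynomial.C ((k n : ℂ) * α) * w n * ∏ t ∈ Finset.univ.erase n, p t
        = 0 := by
      rw [Finset.sum_eq_add i j hij (fun n _ hn => by simp [hw0 n hn]) (by simp) (by simp),
        ← Finset.mul_prod_erase (Finset.univ.erase i) p (a := j) (by simp [hij.symm]),
        ← Finset.mul_prod_erase (Finset.univ.erase j) p (a := i) (by simp [hij]),
        Finset.erase_right_comm, hwi, hwj, hs, hu]
      simp only [MvPolynomial.C_mul, MvPolynomial.C_neg]
      ring
    obtain ⟨-, hv0⟩ := H (-∑ n, (k n : ℂ) * α * c n) v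
      (fun n t => by
        rw [← hdeg]
        exact (MvPolynomial.degreeOf_sub_le _ _ _).trans
          (max_le (hwdeg n t) (MvPolynomial.degreeOf_C_mul_le _ _ _)))
      (fun n => by
        simp only [hv, hc, MvPolynomial.C_mul', map_sub, map_smul, smul_eq_mul]
        rw [div_mul_cancel₀ _ (hφ n), sub_self])
      (by
        rw [sum_mul_sub_mul_prod_erase, hsum, zero_sub, MvPolynomial.C_neg, neg_mul, map_sum]
        simp only [MvPolynomial.C_mul])
    have hvi := hv0 i
    simp only [hv] at hvi
    rw [hwi, hs] at hvi
    exact MvPolynomial.isUnit_of_C_mul_sub_eq_zero hs0 (hk0 j) hvi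
  · intro H a v hvdeg hφv heq
    have hv : ∀ j, v j = 0 := by
      intro j
      have hdvd : p j ∣ MvPolynomial.C ((k j : ℂ) * α) * v j * ∏ t ∈ Finset.univ.erase j, p t := by
        rw [← Finset.add_sum_erase _ _ (Finset.mem_univ j)] at heq
        rw [eq_sub_of_add_eq heq]
        refine dvd_sub ((Finset.dvd_prod_of_mem p (Finset.mem_univ j)).mul_left _)
          (Finset.dvd_sum fun n hn => Dvd.dvd.mul_left (Finset.dvd_prod_of_mem p ?_) _)
        simpa using (Finset.ne_of_mem_erase hn).symm
      have hunit : IsUnit (MvPolynomial.C ((k j : ℂ) * α) : MvPolynomial (Fin ℓ) ℂ) :=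
        (mul_ne_zero (hk0 j) hα).isUnit.map MvPolynomial.C
      have hpv : p j ∣ v j := hunit.dvd_mul_left.1 <| IsRelPrime.dvd_of_dvd_mul_right
        (IsRelPrime.prod_right fun n hn => H j n (Finset.ne_of_mem_erase hn).symm) hdvd
      obtain ⟨c, hc⟩ := MvPolynomial.exists_eq_C_mul_of_dvd_of_degreeOf_le (hp j) hpv
        fun t => (hvdeg j t).trans (hdeg j t).ge
      have h0 := hφv j
      rw [hc, MvPolynomial.C_mul', map_smul, smul_eq_mul] at h0
      rw [hc, (mul_eq_zero.1 h0).resolve_right (hφ j), MvPolynomial.C_0, zero_mul]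
    refine ⟨?_, hv⟩
    simp only [hv, mul_zero, zero_mul, Finset.sum_const_zero] at heq
    have := (mul_eq_zero.1 heq.symm).resolve_right (Finset.prod_ne_zero_iff.2 fun n _ => hp n)
    exact MvPolynomial.C_eq_zero.1 this
end

section
/- (Multiplicity-splitting embedding) Let h ∈ R be irreducible with deg h = n, where n has at least two distinct indices i with n_i > 0 (a non-univariate degree). Let g ∈ R, let k̂, k̃ ≥ 1, f := h^{k̂+k̃} · g, and m := deg f. Then f lies in the closure, in ℙ^m, of the set {h^{k̂} · p^{k̃} · g : p ∈ R irreducible with deg p = n and p not associated to h}. -/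
open scoped Classical

open MvPolynomial
open scoped Topology

section RescaleVar

variable {σ R : Type*} [CommRing R]

/-- The substitution `X i ↦ c * X i` fixing all other variables. -/
noncomputable def rescaleVar (i : σ) (c : R) : MvPolynomial σ R →ₐ[R] MvPolynomial σ R :=
  aeval fun t => C (if t = i then c else 1) * X t

theorem rescaleVar_X (i : σ) (c : R) (t : σ) :
    rescaleVar i c (X t) = C (if t = i then c else 1) * X t := by
  simp [rescaleVar]

theorem rescaleVar_comp (i : σ) (a b : R) :
    (rescaleVar i a).comp (rescaleVar i b) = rescaleVar i (a * b) := by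
  ext1 t
  by_cases ht : t = i
  · simp [rescaleVar_X, ht, algHom_C]
    ring
  · simp [rescaleVar_X, ht]

theorem rescaleVar_one (i : σ) : rescaleVar i (1 : R) = AlgHom.id R (MvPolynomial σ R) := by
  ext1 t
  simp [rescaleVar_X]

theorem rescaleVar_monomial (i : σ) (c : R) (d : σ →₀ ℕ) (r : R) :
    rescaleVar i c (monomial d r) = monomial d (c ^ d i * r) := by
  have hc : (d.prod fun t k => (C (if t = i then c else 1) : MvPolynomial σ R) ^ k)
      = C (c ^ d i) := by
    rw [Finsupp.prod, Finset.prod_eq_single i]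
    · simp
    · intro t _ ht
      simp [ht]
    · intro hi
      simp [Finsupp.notMem_support_iff.mp hi]
  rw [rescaleVar, aeval_monomial]
  simp only [mul_pow]
  rw [Finsupp.prod_mul, hc, monomial_eq (s := d), C_mul, algebraMap_eq]
  ring

theorem coeff_rescaleVar (i : σ) (c : R) (p : MvPolynomial σ R) (d : σ →₀ ℕ) :
    coeff d (rescaleVar i c p) = c ^ d i * coeff d p := by
  induction p using MvPolynomial.induction_on' with
  | monomial u a =>
    rw [rescaleVar_monomial, coeff_monomial, coeff_monomial]
    split_ifs with hu
    · rw [hu]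
    · simp
  | add p q hp hq => simp [hp, hq, mul_add]

theorem map_rescaleVar {S : Type*} [CommRing S] (φ : R →+* S) (i : σ) (c : R)
    (p : MvPolynomial σ R) :
    map φ (rescaleVar i c p) = rescaleVar i (φ c) (map φ p) := by
  ext d
  simp [coeff_rescaleVar, coeff_map]

end RescaleVar

section Field

variable {σ K : Type*} [Field K]

/-- For `c ≠ 0`, rescaling a variable by `c` is an automorphism of the polynomial ring. -/
noncomputable def rescaleVarEquiv (i : σ) {c : K} (hc : c ≠ 0) :
    MvPolynomial σ K ≃ₐ[K] MvPolynomial σ K :=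
  AlgEquiv.ofAlgHom (rescaleVar i c) (rescaleVar i c⁻¹)
    (by rw [rescaleVar_comp, mul_inv_cancel₀ hc, rescaleVar_one])
    (by rw [rescaleVar_comp, inv_mul_cancel₀ hc, rescaleVar_one])

theorem Irreducible.rescaleVar {p : MvPolynomial σ K} (hp : Irreducible p) (i : σ) {c : K}
    (hc : c ≠ 0) : Irreducible (rescaleVar i c p) :=
  (MulEquiv.irreducible_iff (rescaleVarEquiv i hc)).mpr hp

theorem support_rescaleVar (i : σ) {c : K} (hc : c ≠ 0) (p : MvPolynomial σ K) :
    (rescaleVar i c p).support = p.support := by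
  ext d
  simp [mem_support_iff, coeff_rescaleVar, hc]

theorem degreeOf_rescaleVar (i : σ) {c : K} (hc : c ≠ 0) (p : MvPolynomial σ K) (t : σ) :
    (rescaleVar i c p).degreeOf t = p.degreeOf t := by
  rw [degreeOf_eq_sup, degreeOf_eq_sup, support_rescaleVar i hc]

/-- An irreducible polynomial involving two variables is not associated to its rescaling by a
factor all of whose powers are distinct. -/
theorem not_associated_rescaleVar {h : MvPolynomial σ K} (hh : Irreducible h) {i j : σ}
    (hij : i ≠ j) (hi : 0 < h.degreeOf i) (hj : 0 < h.degreeOf j) {c : K}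
    (hc : Function.Injective fun k : ℕ => c ^ k) :
    ¬ Associated (rescaleVar i c h) h := by
  intro hassoc
  obtain ⟨u, hu⟩ := hassoc.symm
  obtain ⟨r, -, hr⟩ := MvPolynomial.isUnit_iff_eq_C_of_isReduced.mp u.isUnit
  have hpow : ∀ d ∈ h.support, c ^ d i = r := by
    intro d hd
    have hd' := congrArg (coeff d) hu
    rw [hr, mul_comm h, coeff_C_mul, coeff_rescaleVar] at hd'
    exact (mul_right_cancel₀ (mem_support_iff.mp hd) hd').symm
  obtain ⟨e, he, hei⟩ : ∃ e ∈ h.support, 0 < e i := by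
    rw [degreeOf_eq_sup] at hi
    simpa using (Finset.lt_sup_iff (a := 0)).mp hi
  have hX : X i ∣ h := by
    rw [X_dvd_iff_modMonomial_eq_zero]
    ext d
    rw [coeff_zero]
    by_cases hle : Finsupp.single i 1 ≤ d
    · exact coeff_modMonomial_of_le _ hle
    · rw [coeff_modMonomial_of_not_le _ hle]
      by_contra hd
      have hde : d i = e i :=
        hc ((hpow d (mem_support_iff.mpr hd)).trans (hpow e he).symm)
      exact hle (Finsupp.single_le_iff.mpr (by omega))
  obtain ⟨q, hq⟩ := hX
  have hXi : ¬ IsUnit (X i : MvPolynomial σ K) := (X_prime (i := i)).not_isUnit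
  obtain ⟨s, -, hs⟩ := MvPolynomial.isUnit_iff_eq_C_of_isReduced.mp
    ((hh.isUnit_or_isUnit hq).resolve_left hXi)
  have hle : h.degreeOf j ≤ 0 := by
    rw [hq, hs]
    refine (degreeOf_mul_le _ _ _).trans ?_
    rw [degreeOf_C, degreeOf_X, if_neg hij.symm]
  omega

end Field

theorem pNorm_eq_sqrt_sum_s11 {ℓ : ℕ} (p : MvPolynomial (Fin ℓ) ℂ) {S : Finset (Fin ℓ →₀ ℕ)}
    (hS : p.support ⊆ S) : pNorm p = Real.sqrt (∑ d ∈ S, ‖coeff d p‖ ^ 2) := by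
  rw [pNorm, pInner, Finset.union_self, Complex.re_sum, Finset.sum_subset hS]
  · simp [← Complex.normSq_eq_conj_mul_self, Complex.normSq_eq_norm_sq, -Complex.ofReal_pow]
  · intro d _ hd
    simp [notMem_support_iff.mp hd]

/-- The coefficient norm is continuous along a polynomial one-parameter family. -/
theorem continuous_pNorm_map_eval {ℓ : ℕ} (Q : MvPolynomial (Fin ℓ) (Polynomial ℂ)) :
    Continuous fun c : ℂ => pNorm (map (Polynomial.evalRingHom c) Q) := by
  simp only [fun c : ℂ => pNorm_eq_sqrt_sum_s11 _ (support_map_subset (Polynomial.evalRingHom c) Q),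
    coeff_map, Polynomial.coe_evalRingHom]
  fun_prop

/-- Multiplicity-splitting embedding: if `h` is irreducible with non-univariate degree `n`,
then `f = h^{k̂+k̃} · g` lies in the closure (in the coefficient-norm topology of `ℙ^m`,
`m = deg f`) of `{h^{k̂} · p^{k̃} · g : p irreducible, deg p = n, p not associated to h}`. -/
theorem multiplicity_splitting_embedding (ℓ : ℕ) (hl : 1 ≤ ℓ)
    (h : MvPolynomial (Fin ℓ) ℂ) (n : Fin ℓ → ℕ)
    (hirr : Irreducible h) (hdeg : ∀ t, h.degreeOf t = n t)
    (hnu : ∃ i j : Fin ℓ, i ≠ j ∧ 0 < n i ∧ 0 < n j)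
    (g : MvPolynomial (Fin ℓ) ℂ) (khat ktil : ℕ) (hkhat : 1 ≤ khat) (hktil : 1 ≤ ktil) :
    ∀ ε : ℝ, 0 < ε →
      ∃ p : MvPolynomial (Fin ℓ) ℂ, Irreducible p ∧
        (∀ t, p.degreeOf t = n t) ∧ ¬ Associated p h ∧
        pNorm (h ^ (khat + ktil) * g - h ^ khat * p ^ ktil * g) < ε := by
  intro ε hε
  obtain ⟨i, j, hij, hi, hj⟩ := hnu
  let ι : ℂ →+* Polynomial ℂ := Polynomial.C
  let Q : MvPolynomial (Fin ℓ) (Polynomial ℂ) :=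
    map ι (h ^ (khat + ktil) * g) -
      map ι (h ^ khat) * rescaleVar i Polynomial.X (map ι h) ^ ktil * map ι g
  have hQ (c : ℂ) : map (Polynomial.evalRingHom c) Q =
      h ^ (khat + ktil) * g - h ^ khat * rescaleVar i c h ^ ktil * g := by
    have hι (q : MvPolynomial (Fin ℓ) ℂ) : map (Polynomial.evalRingHom c) (map ι q) = q := by
      ext d
      simp [ι, coeff_map]
    simp only [Q, map_sub, map_mul (map (Polynomial.evalRingHom c)),
      map_pow (map (Polynomial.evalRingHom c)), map_rescaleVar, hι]
    simp
  have hcont : Continuous fun x : ℝ => pNorm (map (Polynomial.evalRingHom (x : ℂ)) Q) :=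
    (continuous_pNorm_map_eval Q).comp Complex.continuous_ofReal
  have hone : pNorm (map (Polynomial.evalRingHom ((1 : ℝ) : ℂ)) Q) < ε := by
    rw [hQ, Complex.ofReal_one, rescaleVar_one, AlgHom.id_apply, pow_add, sub_self]
    simpa [pNorm, pInner] using hε
  have hnear : ∀ᶠ x : ℝ in 𝓝[>] 1, pNorm (map (Polynomial.evalRingHom (x : ℂ)) Q) < ε :=
    (hcont.continuousAt.eventually_lt continuousAt_const hone).filter_mono nhdsWithin_le_nhds
  obtain ⟨x, hx, hx1⟩ := (hnear.and self_mem_nhdsWithin).exists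
  have hx1 : 1 < x := hx1
  have hx0 : (x : ℂ) ≠ 0 := by
    exact_mod_cast (zero_lt_one.trans hx1).ne'
  have hinj : Function.Injective fun k : ℕ => (x : ℂ) ^ k := by
    intro a b (hab : (x : ℂ) ^ a = (x : ℂ) ^ b)
    have hab' : x ^ a = x ^ b := by exact_mod_cast hab
    exact pow_right_injective₀ (zero_lt_one.trans hx1) hx1.ne' hab'
  refine ⟨rescaleVar i (x : ℂ) h, hirr.rescaleVar i hx0, fun t => ?_, ?_, ?_⟩
  · rw [degreeOf_rescaleVar i hx0, hdeg]
  · exact not_associated_rescaleVar hirr hij (by rwa [hdeg]) (by rwa [hdeg]) hinj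
  · rwa [← hQ]
end
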